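/- There is an absolute constant c > 0 with the following property. Let f be a random p-biased function on 𝒳 with p ∈ (0,1), and let ε ∈ (0,1] and φ : 𝒳 → [0,1]. Then with probability at least 1 − 4·exp(−c·ε²·p²(1−p)² / ‖𝒟_x‖₂²) over the randomness of f, the normalization factor Z is strictly positive and the filtered sample distribution 𝒟 satisfies |Σ_{x∈𝒳} 𝒟(x)φ(x) − Σ_{x∈𝒳} 𝒟_x(x)φ(x)| ≤ ε. -/

import Mathlib

open Finset Real
open scoped Classical BigOperators

noncomputable section

/-- The real value of a boolean function at a point: `1` if `true`, `0` if `false`. -/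
def bval {X : Type} (f : X → Bool) (x : X) : ℝ := if f x then 1 else 0

/-- The probability weight of a particular function `f : X → Bool` when each value
`f x` is an independent Bernoulli(p) random variable. -/
def bweight {X : Type} [Fintype X] (p : ℝ) (f : X → Bool) : ℝ :=
  ∏ x, if f x then p else 1 - p

/-- The probability of an event `P` under a random `p`-biased function. -/
def bprob (X : Type) [Fintype X] (p : ℝ) (P : (X → Bool) → Prop) : ℝ :=
  ∑ f : X → Bool, bweight p f * (if P f then 1 else 0)

/-- The squared 2-norm of a weight function. -/
def norm2sq {X : Type} [Fintype X] (w : X → ℝ) : ℝ := ∑ x, w x ^ 2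

/-- The normalization factor `Z`. -/
def Zval {X : Type} [Fintype X] (Dx yy : X → ℝ) (p : ℝ) (f : X → Bool) : ℝ :=
  ∑ x, Dx x * ((1 - p) * yy x * bval f x + p * (1 - yy x) * (1 - bval f x))

/-- The filtered sample distribution. -/
def filtered {X : Type} [Fintype X] (Dx yy : X → ℝ) (p : ℝ) (f : X → Bool) (x : X) : ℝ :=
  Dx x * ((1 - p) * yy x * bval f x + p * (1 - yy x) * (1 - bval f x)) / Zval Dx yy p f

lemma aux_exp_le (r v : ℝ) (h : |v| ≤ 1) :
    Real.exp (r * v) ≤ Real.cosh r + v * Real.sinh r := by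
  obtain ⟨h1, h2⟩ := abs_le.mp h
  have := convexOn_exp.2 (Set.mem_univ r) (Set.mem_univ (-r))
    (show 0 ≤ (1 + v) / 2 by linarith) (show 0 ≤ (1 - v) / 2 by linarith) (by ring)
  simp only [smul_eq_mul] at this
  rw [show (1 + v) / 2 * r + (1 - v) / 2 * -r = r * v by ring] at this
  rw [Real.cosh_eq, Real.sinh_eq]
  linarith

lemma aux_two (p r a b : ℝ) (hp : 0 < p) (hp1 : p < 1) (ha : |a| ≤ 1) (hb : |b| ≤ 1)
    (h0 : p * a + (1 - p) * b = 0) :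
    p * Real.exp (r * a) + (1 - p) * Real.exp (r * b) ≤ Real.exp (r ^ 2 / 2) := by
  have h1 := mul_le_mul_of_nonneg_left (aux_exp_le r a ha) hp.le
  have h2 := mul_le_mul_of_nonneg_left (aux_exp_le r b hb) (by linarith : 0 ≤ 1 - p)
  have h3 := Real.cosh_le_exp_half_sq r
  have h4 : p * (Real.cosh r + a * Real.sinh r) + (1 - p) * (Real.cosh r + b * Real.sinh r)
      = Real.cosh r := by
    linear_combination Real.sinh r * h0
  linarith

lemma aux_prod {X : Type} [Fintype X] (g : X → Bool → ℝ) :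
    ∑ f : X → Bool, ∏ x, g x (f x) = ∏ x, (g x true + g x false) := by
  have := (Finset.prod_univ_sum (fun _ : X => (Finset.univ : Finset Bool)) g).symm
  rw [Fintype.piFinset_univ] at this
  simpa using this

lemma aux_weight_sum {X : Type} [Fintype X] (p : ℝ) :
    ∑ f : X → Bool, bweight p f = 1 := by
  have := aux_prod (X := X) (fun _ b => if b then p else 1 - p)
  simpa [bweight] using this

lemma aux_weight_nonneg {X : Type} [Fintype X] (p : ℝ) (hp : 0 < p) (hp1 : p < 1)
    (f : X → Bool) : 0 ≤ bweight p f := by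
  apply Finset.prod_nonneg
  intro x _
  split_ifs <;> linarith

lemma aux_tail {X : Type} [Fintype X] (p t : ℝ) (hp : 0 < p) (hp1 : p < 1) (ht : 0 ≤ t)
    (D : X → ℝ) (hV : 0 < norm2sq D) (v : X → Bool → ℝ) (hv : ∀ x b, |v x b| ≤ 1)
    (h0 : ∀ x, p * v x true + (1 - p) * v x false = 0) :
    bprob X p (fun f => t ≤ ∑ x, D x * v x (f x)) ≤ Real.exp (-(t ^ 2) / (2 * norm2sq D)) := by
  set s := t / norm2sq D with hs
  have hs0 : 0 ≤ s := div_nonneg ht hV.le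
  have key : ∑ f : X → Bool, bweight p f * Real.exp (s * ∑ x, D x * v x (f x))
      ≤ Real.exp (s ^ 2 * norm2sq D / 2) := by
    calc _ = ∑ f : X → Bool, ∏ x,
          ((if f x then p else 1 - p) * Real.exp ((s * D x) * v x (f x))) := by
          apply Finset.sum_congr rfl
          intro f _
          rw [Finset.prod_mul_distrib, ← Real.exp_sum, Finset.mul_sum, bweight]
          simp only [mul_assoc]
      _ = ∏ x, (p * Real.exp ((s * D x) * v x true)
            + (1 - p) * Real.exp ((s * D x) * v x false)) := by
          have := aux_prod (X := X)
            (fun x b => (if b then p else 1 - p) * Real.exp ((s * D x) * v x b))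
          simpa using this
      _ ≤ ∏ x, Real.exp ((s * D x) ^ 2 / 2) := by
          apply Finset.prod_le_prod
          · intro x _
            have : 0 < 1 - p := by linarith
            positivity
          · intro x _
            exact aux_two p _ _ _ hp hp1 (hv x _) (hv x _) (h0 x)
      _ = _ := by
          rw [← Real.exp_sum, norm2sq, Finset.mul_sum, Finset.sum_div]
          simp only [mul_pow]
  calc bprob X p (fun f => t ≤ ∑ x, D x * v x (f x))
      ≤ ∑ f : X → Bool, (bweight p f * Real.exp (s * ∑ x, D x * v x (f x)))
          * Real.exp (-(s * t)) := by
        apply Finset.sum_le_sum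
        intro f _
        rw [mul_assoc]
        apply mul_le_mul_of_nonneg_left _ (aux_weight_nonneg p hp hp1 f)
        rw [← Real.exp_add]
        split_ifs with h
        · apply Real.one_le_exp
          have := mul_le_mul_of_nonneg_left h hs0
          linarith
        · exact (Real.exp_pos _).le
    _ ≤ Real.exp (s ^ 2 * norm2sq D / 2) * Real.exp (-(s * t)) := by
        rw [← Finset.sum_mul]
        exact mul_le_mul_of_nonneg_right key (Real.exp_pos _).le
    _ = _ := by
        rw [← Real.exp_add]
        congr 1
        rw [hs]
        field_simp
        ring

lemma aux_det (N Z m q ε : ℝ) (hq : 0 < q) (he : 0 < ε) (he1 : ε ≤ 1) (hm0 : 0 ≤ m)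
    (hm1 : m ≤ 1) (h1 : N - m * q < ε * q / 4) (h2 : -(N - m * q) < ε * q / 4)
    (h3 : Z - q < ε * q / 4) (h4 : -(Z - q) < ε * q / 4) :
    0 < Z ∧ |N / Z - m| ≤ ε := by
  have hqe : ε * q ≤ q := by nlinarith
  have hqe0 : 0 < ε * q := by positivity
  have hZ : 0 < Z := by linarith
  refine ⟨hZ, ?_⟩
  have hmB1 : m * (Z - q) ≤ ε * q / 4 := by nlinarith
  have hmB2 : -(ε * q / 4) ≤ m * (Z - q) := by nlinarith
  have hZ2 : ε * q / 2 ≤ ε * Z := by nlinarith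
  have : N / Z - m = (N - m * Z) / Z := by field_simp
  rw [this, abs_div, abs_of_pos hZ, div_le_iff₀ hZ, abs_le]
  constructor <;> nlinarith

theorem stmt6 : ∃ c : ℝ, 0 < c ∧
    ∀ (X : Type) [Fintype X], ∀ (Dx yy : X → ℝ) (p ε : ℝ) (φ : X → ℝ),
      (∀ x, 0 ≤ Dx x) → (∀ x, Dx x ≤ 1) → (∑ x, Dx x) = 1 →
      (∀ x, 0 ≤ yy x) → (∀ x, yy x ≤ 1) →
      0 < p → p < 1 → 0 < ε → ε ≤ 1 →
      (∀ x, 0 ≤ φ x) → (∀ x, φ x ≤ 1) →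
      bprob X p (fun f =>
          0 < Zval Dx yy p f ∧
          |(∑ x, filtered Dx yy p f x * φ x) - ∑ x, Dx x * φ x| ≤ ε) ≥
        1 - 4 * Real.exp (-(c * ε ^ 2 * p ^ 2 * (1 - p) ^ 2) / norm2sq Dx) := by
  refine ⟨1 / 32, by norm_num, ?_⟩
  intro X _ Dx yy p ε φ hD0 hD1 hDs hy0 hy1 hp hp1 he he1 hφ0 hφ1
  have hV : 0 < norm2sq Dx := by
    obtain ⟨x, -, hx⟩ := Finset.exists_ne_zero_of_sum_ne_zero
      (show ∑ x, Dx x ≠ 0 by rw [hDs]; norm_num)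
    exact Finset.sum_pos' (fun i _ => sq_nonneg _) ⟨x, Finset.mem_univ _, by positivity⟩
  have hp' : 0 < 1 - p := by linarith
  set q := p * (1 - p) with hq
  have hq0 : 0 < q := by positivity
  have hq1 : q ≤ 1 := by nlinarith
  set t := ε * q / 4 with ht
  have ht0 : 0 ≤ t := by positivity
  let u : X → Bool → ℝ := fun x b => (if b then (1 - p) * yy x else p * (1 - yy x)) - q
  have hu : ∀ x b, |u x b| ≤ 1 := by
    intro x b
    have a1 := hy0 x
    have a2 := hy1 x
    have b1 : 0 ≤ (1 - p) * yy x := by positivity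
    have b2 : (1 - p) * yy x ≤ 1 := by nlinarith
    have b3 : 0 ≤ p * (1 - yy x) := mul_nonneg hp.le (by linarith)
    have b4 : p * (1 - yy x) ≤ 1 := by nlinarith
    cases b <;> simp only [u, abs_le] <;> constructor <;> simp <;> linarith
  have hu0 : ∀ x, p * u x true + (1 - p) * u x false = 0 := by
    intro x
    simp only [u, hq]
    simp
    ring
  have hφu : ∀ x b, |φ x * u x b| ≤ 1 := by
    intro x b
    rw [abs_mul, abs_of_nonneg (hφ0 x)]
    exact mul_le_one₀ (hφ1 x) (abs_nonneg _) (hu x b)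
  have T1 := aux_tail p t hp hp1 ht0 Dx hV (fun x b => φ x * u x b) hφu
    (fun x => by linear_combination φ x * hu0 x)
  have T2 := aux_tail p t hp hp1 ht0 Dx hV (fun x b => -(φ x * u x b))
    (fun x b => by rw [abs_neg]; exact hφu x b)
    (fun x => by linear_combination -φ x * hu0 x)
  have T3 := aux_tail p t hp hp1 ht0 Dx hV u hu hu0
  have T4 := aux_tail p t hp hp1 ht0 Dx hV (fun x b => -(u x b))
    (fun x b => by rw [abs_neg]; exact hu x b)
    (fun x => by linear_combination - hu0 x)
  have hexp : -(t ^ 2) / (2 * norm2sq Dx)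
      = -(1 / 32 * ε ^ 2 * p ^ 2 * (1 - p) ^ 2) / norm2sq Dx := by
    rw [ht, hq]
    field_simp
    norm_num
  rw [hexp] at T1 T2 T3 T4
  set m := ∑ x, Dx x * φ x with hm
  have hm0 : 0 ≤ m := Finset.sum_nonneg (fun x _ => mul_nonneg (hD0 x) (hφ0 x))
  have hm1 : m ≤ 1 := by
    rw [← hDs]
    exact Finset.sum_le_sum (fun x _ => mul_le_of_le_one_right (hD0 x) (hφ1 x))
  have hg : ∀ f : X → Bool, ∀ x,
      (1 - p) * yy x * bval f x + p * (1 - yy x) * (1 - bval f x) = u x (f x) + q := by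
    intro f x
    cases h : f x <;> simp [u, bval, h]
  have hZ : ∀ f : X → Bool, Zval Dx yy p f - q = ∑ x, Dx x * u x (f x) := by
    intro f
    simp only [Zval, hg, mul_add, Finset.sum_add_distrib, ← Finset.sum_mul, hDs]
    ring
  have hN : ∀ f : X → Bool, (∑ x, Dx x * (u x (f x) + q) * φ x) - m * q
      = ∑ x, Dx x * (φ x * u x (f x)) := by
    intro f
    rw [hm, Finset.sum_mul, ← Finset.sum_sub_distrib]
    exact Finset.sum_congr rfl (fun x _ => by ring)
  have hF : ∀ f : X → Bool, (∑ x, filtered Dx yy p f x * φ x)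
      = (∑ x, Dx x * (u x (f x) + q) * φ x) / Zval Dx yy p f := by
    intro f
    rw [Finset.sum_div]
    exact Finset.sum_congr rfl (fun x _ => by rw [filtered, hg]; ring)
  have union : (1 : ℝ) ≤ bprob X p (fun f =>
          0 < Zval Dx yy p f ∧
          |(∑ x, filtered Dx yy p f x * φ x) - m| ≤ ε)
      + bprob X p (fun f => t ≤ ∑ x, Dx x * (φ x * u x (f x)))
      + bprob X p (fun f => t ≤ ∑ x, Dx x * -(φ x * u x (f x)))
      + bprob X p (fun f => t ≤ ∑ x, Dx x * u x (f x))
      + bprob X p (fun f => t ≤ ∑ x, Dx x * -(u x (f x))) := by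
    rw [← aux_weight_sum (X := X) p]
    simp only [bprob, ← Finset.sum_add_distrib, ← mul_add]
    apply Finset.sum_le_sum
    intro f _
    apply le_mul_of_one_le_right (aux_weight_nonneg p hp hp1 f)
    have ind : ∀ P : Prop, (0 : ℝ) ≤ if P then 1 else 0 := by
      intro P; split_ifs <;> norm_num
    by_cases c1 : t ≤ ∑ x, Dx x * (φ x * u x (f x))
    · rw [if_pos c1]
      linarith [ind (0 < Zval Dx yy p f ∧ |(∑ x, filtered Dx yy p f x * φ x) - m| ≤ ε),
        ind (t ≤ ∑ x, Dx x * -(φ x * u x (f x))), ind (t ≤ ∑ x, Dx x * u x (f x)),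
        ind (t ≤ ∑ x, Dx x * -(u x (f x)))]
    by_cases c2 : t ≤ ∑ x, Dx x * -(φ x * u x (f x))
    · rw [if_neg c1, if_pos c2]
      linarith [ind (0 < Zval Dx yy p f ∧ |(∑ x, filtered Dx yy p f x * φ x) - m| ≤ ε),
        ind (t ≤ ∑ x, Dx x * u x (f x)), ind (t ≤ ∑ x, Dx x * -(u x (f x)))]
    by_cases c3 : t ≤ ∑ x, Dx x * u x (f x)
    · rw [if_neg c1, if_neg c2, if_pos c3]
      linarith [ind (0 < Zval Dx yy p f ∧ |(∑ x, filtered Dx yy p f x * φ x) - m| ≤ ε),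
        ind (t ≤ ∑ x, Dx x * -(u x (f x)))]
    by_cases c4 : t ≤ ∑ x, Dx x * -(u x (f x))
    · rw [if_neg c1, if_neg c2, if_neg c3, if_pos c4]
      linarith [ind (0 < Zval Dx yy p f ∧ |(∑ x, filtered Dx yy p f x * φ x) - m| ≤ ε)]
    have good : 0 < Zval Dx yy p f ∧ |(∑ x, filtered Dx yy p f x * φ x) - m| ≤ ε := by
      rw [hF]
      simp only [mul_neg, Finset.sum_neg_distrib] at c2 c4
      rw [← hN] at c1 c2
      rw [← hZ] at c3 c4
      exact aux_det _ _ m q ε hq0 he he1 hm0 hm1 (not_le.mp c1) (not_le.mp c2)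
        (not_le.mp c3) (not_le.mp c4)
    rw [if_pos good, if_neg c1, if_neg c2, if_neg c3, if_neg c4]
    norm_num
  linarith

end
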